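/- arXiv:math/0310005 — 4 statements merged into one kernel-verified Lean document; each statement's English description precedes it below -/
import Mathlib

section
/- Let F = {f_n(q)}_{n=1}^∞ and G = {g_n(q)}_{n=1}^∞ be sequences of rational functions with rational coefficients satisfying the functional equation for multiplication of quantum integers, with supp(F) = supp(G). Let r and s be positive integers and let d and e be integers. Define h_n(q) = f_n(q^r)^d · g_n(q^s)^e for n ∈ supp(F) and h_n(q) = 0 for n ∉ supp(F). Then the sequence H = {h_n(q)}_{n=1}^∞ satisfies the functional equation for multiplication of quantum integers and supp(H) = supp(F). -/
open scoped Classical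

open Polynomial

/-- Substitution of `q^m` for the variable `q` in a rational function `f ∈ RatFunc ℚ`:
`f(q^m) = num(q^m) / denom(q^m)`. -/
noncomputable def qSubst (m : ℕ) (f : RatFunc ℚ) : RatFunc ℚ :=
  (f.num.eval₂ RatFunc.C (RatFunc.X ^ m)) / (f.denom.eval₂ RatFunc.C (RatFunc.X ^ m))

/-- A sequence of rational functions satisfies the functional equation for
multiplication of quantum integers if `f_{mn}(q) = f_m(q) · f_n(q^m)` for all
positive integers `m` and `n`. -/
def SatisfiesFE (f : ℕ → RatFunc ℚ) : Prop :=
  ∀ m n : ℕ, 0 < m → 0 < n → f (m * n) = f m * qSubst m (f n)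

/-- Substitution of `q^m` for `q`, as a ring endomorphism of `RatFunc ℚ`, for positive `m`. -/
noncomputable def qSubstHom (m : ℕ) (hm : 0 < m) : RatFunc ℚ →+* RatFunc ℚ :=
  RatFunc.mapRingHom (expand ℚ m)
    (nonZeroDivisors_le_comap_nonZeroDivisors_of_injective _ (expand_injective hm))

theorem eval₂_C_X_pow (m : ℕ) (p : ℚ[X]) :
    p.eval₂ RatFunc.C (RatFunc.X ^ m) = algebraMap ℚ[X] (RatFunc ℚ) (expand ℚ m p) := by
  rw [expand_eq_sum, Polynomial.eval₂_eq_sum, Polynomial.sum, Polynomial.sum, map_sum]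
  simp

theorem qSubstHom_apply (m : ℕ) (hm : 0 < m) (x : RatFunc ℚ) : qSubstHom m hm x = qSubst m x := by
  rw [qSubst, eval₂_C_X_pow, eval₂_C_X_pow, qSubstHom, RatFunc.coe_mapRingHom_eq_coe_map,
    RatFunc.map_apply]

theorem qSubstHom_algebraMap (m : ℕ) (hm : 0 < m) (p : ℚ[X]) :
    qSubstHom m hm (algebraMap ℚ[X] (RatFunc ℚ) p) = algebraMap _ _ (expand ℚ m p) := by
  rw [qSubstHom_apply, qSubst, RatFunc.num_algebraMap, RatFunc.denom_algebraMap, eval₂_C_X_pow,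
    eval₂_one, div_one]

theorem qSubst_mul (m : ℕ) (hm : 0 < m) (x y : RatFunc ℚ) :
    qSubst m (x * y) = qSubst m x * qSubst m y := by
  simp only [← qSubstHom_apply m hm, map_mul]

theorem qSubst_zpow (m : ℕ) (hm : 0 < m) (x : RatFunc ℚ) (k : ℤ) :
    qSubst m (x ^ k) = qSubst m x ^ k := by
  simp only [← qSubstHom_apply m hm, map_zpow₀]

theorem qSubst_eq_zero_iff (m : ℕ) (hm : 0 < m) (x : RatFunc ℚ) : qSubst m x = 0 ↔ x = 0 := by
  rw [← qSubstHom_apply m hm, map_eq_zero]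

theorem qSubst_qSubst (a b : ℕ) (ha : 0 < a) (hb : 0 < b) (x : RatFunc ℚ) :
    qSubst a (qSubst b x) = qSubst (a * b) x := by
  simp only [← qSubstHom_apply a ha, ← qSubstHom_apply b hb,
    ← qSubstHom_apply (a * b) (Nat.mul_pos ha hb)]
  conv_lhs => rw [← RatFunc.num_div_denom x]
  conv_rhs => rw [← RatFunc.num_div_denom x]
  simp only [map_div₀, qSubstHom_algebraMap, expand_expand]

theorem qSubst_comm (a b : ℕ) (ha : 0 < a) (hb : 0 < b) (x : RatFunc ℚ) :
    qSubst a (qSubst b x) = qSubst b (qSubst a x) := by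
  rw [qSubst_qSubst a b ha hb, qSubst_qSubst b a hb ha, Nat.mul_comm]

/-- Support of a product index for a solution of the functional equation. -/
theorem SatisfiesFE.mul_ne_zero_iff {f : ℕ → RatFunc ℚ} (hf : SatisfiesFE f) {m n : ℕ}
    (hm : 0 < m) (hn : 0 < n) : f (m * n) ≠ 0 ↔ f m ≠ 0 ∧ f n ≠ 0 := by
  rw [hf m n hm hn, _root_.mul_ne_zero_iff, Ne, Ne, Ne, qSubst_eq_zero_iff m hm]

/-- If `F` and `G` are solutions of the functional equation with the same support,
`r, s` are positive integers and `d, e` are integers, then the sequence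
`h_n(q) = f_n(q^r)^d · g_n(q^s)^e` (set to `0` off the support) is also a solution
of the functional equation, with the same support as `F`. -/
theorem fe_combination (f g : ℕ → RatFunc ℚ)
    (hf : SatisfiesFE f) (hg : SatisfiesFE g)
    (hsupp : ∀ n : ℕ, 0 < n → (f n ≠ 0 ↔ g n ≠ 0))
    (r s : ℕ) (hr : 0 < r) (hs : 0 < s) (d e : ℤ)
    (h : ℕ → RatFunc ℚ)
    (hh : ∀ n : ℕ, 0 < n →
      h n = if f n ≠ 0 then (qSubst r (f n)) ^ d * (qSubst s (g n)) ^ e else 0) :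
    SatisfiesFE h ∧ ∀ n : ℕ, 0 < n → (h n ≠ 0 ↔ f n ≠ 0) := by
  constructor
  · intro m n hm hn
    rw [hh m hm, hh n hn, hh (m * n) (Nat.mul_pos hm hn)]
    by_cases h1 : f m = 0
    · simp [h1, hf m n hm hn]
    by_cases h2 : f n = 0
    · simp [h2, hf m n hm hn, (qSubst_eq_zero_iff m hm _).2]
    rw [if_pos ((hf.mul_ne_zero_iff hm hn).2 ⟨h1, h2⟩), if_pos h1, if_pos h2, hf m n hm hn,
      hg m n hm hn, qSubst_mul r hr, qSubst_mul s hs, qSubst_mul m hm, qSubst_zpow m hm,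
      qSubst_zpow m hm, qSubst_comm r m hr hm, qSubst_comm s m hs hm, mul_zpow, mul_zpow]
    ring
  · intro n hn
    rw [hh n hn]
    by_cases h1 : f n = 0
    · simp [h1]
    have h2 : g n ≠ 0 := (hsupp n hn).1 h1
    rw [if_pos h1]
    refine iff_of_true (mul_ne_zero (zpow_ne_zero _ ?_) (zpow_ne_zero _ ?_)) h1
    · rwa [Ne, qSubst_eq_zero_iff r hr]
    · rwa [Ne, qSubst_eq_zero_iff s hs]
end

section
/- Let K be an algebraically closed field and let {f_n : K → K}_{n=1}^∞ be a sequence of functions satisfying f_{mn}(q) = f_m(q)·f_n(q^m) for all q ∈ K and all positive integers m and n. Suppose there is a set P of prime numbers with at least two elements such that the set of indices n for which f_n is not identically zero equals S(P), and suppose that for every n ∈ S(P) the zero set {a ∈ K : f_n(a) = 0} is finite. Then for every n ∈ S(P), every a ∈ K with f_n(a) = 0 is either 0 or a root of unity. -/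
/-- `S(P)`: the multiplicative semigroup of positive integers generated by the
set `P` of primes, i.e. the positive integers all of whose prime factors lie in `P`. -/
def SP (P : Set ℕ) : Set ℕ :=
  {n : ℕ | 0 < n ∧ ∀ p : ℕ, p.Prime → p ∣ n → p ∈ P}

/-- An element of a field is zero or a root of unity if and only if one of its positive powers is. -/
lemma eq_zero_or_root_of_unity_pow_iff {K : Type*} [Field K] {x : K} {m : ℕ} (hm : 0 < m) :
    (x ^ m = 0 ∨ ∃ k : ℕ, 0 < k ∧ (x ^ m) ^ k = 1) ↔ (x = 0 ∨ ∃ k : ℕ, 0 < k ∧ x ^ k = 1) := by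
  constructor
  · rintro (h | ⟨k, hk, h⟩)
    · exact Or.inl (eq_zero_of_pow_eq_zero h)
    · exact Or.inr ⟨m * k, Nat.mul_pos hm hk, by rw [pow_mul, h]⟩
  · rintro (h | ⟨k, hk, h⟩)
    · exact Or.inl (by rw [h, zero_pow hm.ne'])
    · exact Or.inr ⟨k, hk, by rw [pow_right_comm, h, one_pow]⟩

/-- If two distinct powers of `x` agree, then `x` is zero or a root of unity. -/
lemma eq_zero_or_root_of_unity_of_pow_eq_pow {K : Type*} [Field K] {x : K} {m n : ℕ}
    (hmn : m ≠ n) (h : x ^ m = x ^ n) : x = 0 ∨ ∃ k : ℕ, 0 < k ∧ x ^ k = 1 := by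
  wlog hlt : m < n generalizing m n
  · exact this hmn.symm h.symm (by omega)
  refine or_iff_not_imp_left.mpr fun hx => ⟨n - m, by omega, ?_⟩
  apply mul_left_cancel₀ (pow_ne_zero m hx)
  rw [← pow_add, Nat.add_sub_cancel' hlt.le, mul_one, h]

/-- Powers of two distinct primes differ, unless both exponents vanish. -/
lemma Nat.Prime.pow_ne_pow_of_ne {p q : ℕ} (hp : p.Prime) (hq : q.Prime) (hpq : p ≠ q)
    {s t : ℕ} (hst : 0 < s + t) : p ^ s ≠ q ^ t := by
  intro h
  have hc : Nat.Coprime (p ^ s) (q ^ t) := Nat.Coprime.pow s t ((Nat.coprime_primes hp hq).2 hpq)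
  have h1 : p ^ s = 1 := by rwa [← h, Nat.coprime_self] at hc
  have hs : s = 0 := by simpa [hp.ne_one] using h1
  have ht : t = 0 := by simpa [hq.ne_one] using h.symm.trans h1
  omega

/-- Let `p` and `q` be distinct primes. If every element `x` of a finite set `S` has some `y ∈ S`
with `y ^ p ^ s = x ^ q ^ t` where `s` and `t` are not both zero, then every element of `S` is zero
or a root of unity. -/
lemma eq_zero_or_root_of_unity_of_finite {K : Type*} [Field K] {p q : ℕ} (hp : p.Prime)
    (hq : q.Prime) (hpq : p ≠ q) {S : Set K} (hS : S.Finite)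
    (hstep : ∀ x ∈ S, ∃ y ∈ S, ∃ s t : ℕ, 0 < s + t ∧ y ^ p ^ s = x ^ q ^ t)
    {a : K} (ha : a ∈ S) : a = 0 ∨ ∃ k : ℕ, 0 < k ∧ a ^ k = 1 := by
  by_contra hbad
  let T : Set K := {x ∈ S | ¬ (x = 0 ∨ ∃ k : ℕ, 0 < k ∧ x ^ k = 1)}
  have : Finite T := hS.subset (Set.sep_subset _ _)
  let r : T → T → Prop := fun y x => ∃ s t : ℕ, 0 < s + t ∧ (y : K) ^ p ^ s = (x : K) ^ q ^ t
  have : IsTrans T r := ⟨by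
    rintro z y x ⟨s, t, hst, h⟩ ⟨s', t', hst', h'⟩
    refine ⟨s + s', t' + t, by omega, ?_⟩
    rw [pow_add, pow_mul, h, pow_right_comm, h', ← pow_mul, ← pow_add]⟩
  have : Std.Irrefl r := ⟨by
    rintro x ⟨s, t, hst, h⟩
    exact x.2.2 (eq_zero_or_root_of_unity_of_pow_eq_pow (hp.pow_ne_pow_of_ne hq hpq hst) h)⟩
  obtain ⟨x, -, hx⟩ := (Finite.wellFounded_of_trans_of_irrefl r).has_min Set.univ
    ⟨⟨a, ha, hbad⟩, trivial⟩
  obtain ⟨y, hy, s, t, hst, h⟩ := hstep x x.2.1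
  refine hx ⟨y, hy, fun hgood => x.2.2 ?_⟩ trivial ⟨s, t, hst, h⟩
  rwa [← eq_zero_or_root_of_unity_pow_iff (pow_pos hp.pos s), h,
    eq_zero_or_root_of_unity_pow_iff (pow_pos hq.pos t)] at hgood

/-- If `g` and `h` have finitely many zeros and satisfy `g(x) h(x ^ p) = h(x) g(x ^ q)` for distinct
primes `p` and `q`, then every zero of `g` is zero or a root of unity. -/
lemma eq_zero_or_root_of_unity_of_mul_comp_pow {K : Type*} [Field K] [IsAlgClosed K] {p q : ℕ}
    (hp : p.Prime) (hq : q.Prime) (hpq : p ≠ q) {g h : K → K}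
    (hgh : ∀ x, g x * h (x ^ p) = h x * g (x ^ q))
    (hg : {x | g x = 0}.Finite) (hh : {x | h x = 0}.Finite) {a : K} (ha : g a = 0) :
    a = 0 ∨ ∃ k : ℕ, 0 < k ∧ a ^ k = 1 := by
  have step : ∀ x, h x = 0 → ∃ y ∈ {x | g x = 0} ∪ {x | h x = 0}, ∃ s t : ℕ,
      0 < s + t ∧ y ^ p ^ s = x ^ q ^ t := by
    intro x hx
    obtain ⟨y, rfl⟩ := IsAlgClosed.exists_pow_nat_eq x hp.pos
    have hy : h y * g (y ^ q) = 0 := by rw [← hgh, hx, mul_zero]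
    rcases mul_eq_zero.mp hy with hy | hy
    · exact ⟨y, Or.inr hy, 1, 0, by omega, by simp⟩
    · exact ⟨y ^ q, Or.inl hy, 1, 1, by omega, by rw [pow_one, pow_one, pow_right_comm]⟩
  refine eq_zero_or_root_of_unity_of_finite hp hq hpq (hg.union hh) ?_ (Or.inl ha)
  rintro x (hx | hx)
  · have hx' : h x * g (x ^ q) = 0 := by
      rw [← hgh, show g x = 0 from hx, zero_mul]
    rcases mul_eq_zero.mp hx' with hx' | hx'
    · exact step x hx'
    · exact ⟨x ^ q, Or.inl hx', 0, 1, by omega, by simp⟩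
  · exact step x hx

/-- A prime in `P` belongs to `S(P)`. -/
lemma Nat.Prime.mem_SP {P : Set ℕ} {p : ℕ} (hp : p.Prime) (hpP : p ∈ P) : p ∈ SP P :=
  ⟨hp.pos, fun r hr hrp => by rwa [(Nat.prime_dvd_prime_iff_eq hr hp).mp hrp]⟩

/-- Let `K` be an algebraically closed field and `{f_n : K → K}` a sequence of
functions satisfying `f_{mn}(q) = f_m(q)·f_n(q^m)`.  If the set of indices `n`
(among the positive integers) for which `f_n` is not identically zero equals
`S(P)` for a set `P` of primes with at least two elements, and each `f_n` with
`n ∈ S(P)` has only finitely many zeros, then every zero of such an `f_n` is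
either `0` or a root of unity. -/
theorem zeros_are_roots_of_unity (K : Type*) [Field K] [IsAlgClosed K]
    (f : ℕ → K → K)
    (hf : ∀ m n : ℕ, 0 < m → 0 < n → ∀ q : K, f (m * n) q = f m q * f n (q ^ m))
    (P : Set ℕ) (hP : ∀ p ∈ P, p.Prime) (hP2 : P.Nontrivial)
    (hsupp : ∀ n : ℕ, 0 < n → (f n ≠ 0 ↔ n ∈ SP P))
    (hfin : ∀ n ∈ SP P, {a : K | f n a = 0}.Finite)
    (n : ℕ) (hn : n ∈ SP P) (a : K) (ha : f n a = 0) :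
    a = 0 ∨ ∃ k : ℕ, 0 < k ∧ a ^ k = 1 := by
  have hprime : ∀ p ∈ P, ∀ b : K, f p b = 0 → b = 0 ∨ ∃ k : ℕ, 0 < k ∧ b ^ k = 1 := by
    intro p hpP b hb
    obtain ⟨q, hqP, hqp⟩ := hP2.exists_ne p
    have hp := hP p hpP
    have hq := hP q hqP
    refine eq_zero_or_root_of_unity_of_mul_comp_pow hp hq hqp.symm (fun x => ?_)
      (hfin p (hp.mem_SP hpP)) (hfin q (hq.mem_SP hqP)) hb
    rw [← hf p q hp.pos hq.pos, ← hf q p hq.pos hp.pos, mul_comm]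
  induction n using Nat.recOnMul generalizing a with
  | zero => exact absurd hn.1 (lt_irrefl 0)
  | one =>
    obtain ⟨p, hpP⟩ := hP2.nonempty
    refine hprime p hpP a ?_
    rw [← one_mul p, hf 1 p one_pos (hP p hpP).pos, ha, zero_mul]
  | prime p hp => exact hprime p (hn.2 p hp dvd_rfl) a ha
  | mul m l ihm ihl =>
    have hm : 0 < m := Nat.pos_of_mul_pos_right hn.1
    have hl : 0 < l := Nat.pos_of_mul_pos_left hn.1
    rw [hf m l hm hl] at ha
    rcases mul_eq_zero.mp ha with h | h
    · exact ihm ⟨hm, fun r hr hrm => hn.2 r hr (hrm.mul_right l)⟩ a h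
    · exact (eq_zero_or_root_of_unity_pow_iff hm).mp
        (ihl ⟨hl, fun r hr hrl => hn.2 r hr (hrl.mul_left m)⟩ _ h)
end

section
/- Let U and U' be finite multisets of positive integers. Then ∏_{u∈U} (q^u − 1) = ∏_{u'∈U'} (q^{u'} − 1) in the polynomial ring ℚ[q] if and only if U = U' as multisets. -/
open Polynomial

/-- If a product of the polynomials `q^v - 1` equals a product having `q^u - 1` as a factor, then
`u` divides one of the exponents `v`: evaluate at a primitive `u`-th root of unity. -/
theorem exists_dvd_of_prod_X_pow_sub_one_eq {U V : Multiset ℕ}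
    (h : (U.map (fun u => (X : Polynomial ℚ) ^ u - 1)).prod =
      (V.map (fun v => (X : Polynomial ℚ) ^ v - 1)).prod)
    {u : ℕ} (hu : u ∈ U) (hpos : 0 < u) : ∃ v ∈ V, u ∣ v := by
  have hζ := Complex.isPrimitiveRoot_exp u hpos.ne'
  set ζ := Complex.exp (2 * Real.pi * Complex.I / u)
  have hroot : aeval ζ (U.map (fun u => (X : Polynomial ℚ) ^ u - 1)).prod = 0 := by
    rw [map_multiset_prod, Multiset.map_map]
    exact Multiset.prod_eq_zero (Multiset.mem_map.2 ⟨u, hu, by simp [hζ.pow_eq_one]⟩)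
  rw [h, map_multiset_prod, Multiset.map_map, Multiset.prod_eq_zero_iff, Multiset.mem_map] at hroot
  obtain ⟨v, hv, hv0⟩ := hroot
  exact ⟨v, hv, hζ.dvd_of_pow_eq_one v (by simpa [sub_eq_zero] using hv0)⟩

/-- Let `U` and `U'` be finite multisets of positive integers.  Then
`∏_{u ∈ U} (q^u − 1) = ∏_{u' ∈ U'} (q^{u'} − 1)` in `ℚ[q]` if and only if
`U = U'` as multisets. -/
theorem prod_F_eq_iff_multiset_eq (U U' : Multiset ℕ)
    (hU : ∀ u ∈ U, 0 < u) (hU' : ∀ u ∈ U', 0 < u) :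
    (U.map (fun u => (X : Polynomial ℚ) ^ u - 1)).prod =
      (U'.map (fun u => (X : Polynomial ℚ) ^ u - 1)).prod ↔ U = U' := by
  refine ⟨fun h => ?_, fun h => by rw [h]⟩
  induction U using Multiset.strongInductionOn generalizing U' with
  | ih U ih =>
    rcases eq_or_ne U 0 with rfl | hne
    · refine (Multiset.eq_zero_of_forall_notMem fun v hv => ?_).symm
      obtain ⟨w, hw, -⟩ := exists_dvd_of_prod_X_pow_sub_one_eq h.symm hv (hU' v hv)
      exact Multiset.notMem_zero w hw
    · obtain ⟨m, hm, hmax⟩ := U.toFinset.exists_max_image id (Multiset.toFinset_nonempty.2 hne)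
      rw [Multiset.mem_toFinset] at hm
      obtain ⟨v, hv, hmv⟩ := exists_dvd_of_prod_X_pow_sub_one_eq h hm (hU m hm)
      obtain ⟨w, hw, hvw⟩ := exists_dvd_of_prod_X_pow_sub_one_eq h.symm hv (hU' v hv)
      have hwm : w ≤ m := hmax w (Multiset.mem_toFinset.2 hw)
      obtain rfl : v = m :=
        le_antisymm ((Nat.le_of_dvd (hU w hw) hvw).trans hwm) (Nat.le_of_dvd (hU' v hv) hmv)
      obtain ⟨A, rfl⟩ := Multiset.exists_cons_of_mem hm
      obtain ⟨B, rfl⟩ := Multiset.exists_cons_of_mem hv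
      have hne0 : (X : Polynomial ℚ) ^ v - 1 ≠ 0 := (monic_X_pow_sub_C 1 (hU v hm).ne').ne_zero
      rw [Multiset.map_cons, Multiset.map_cons, Multiset.prod_cons, Multiset.prod_cons] at h
      rw [ih A (Multiset.lt_cons_self A v) B (fun u hu => hU u (Multiset.mem_cons_of_mem hu))
        (fun u hu => hU' u (Multiset.mem_cons_of_mem hu)) (mul_left_cancel₀ hne0 h)]
end

section
/- Let U, V be disjoint finite multisets of positive integers and let U', V' be disjoint finite multisets of positive integers. If ∏_{u∈U} (q^u − 1) / ∏_{v∈V} (q^v − 1) = ∏_{u'∈U'} (q^{u'} − 1) / ∏_{v'∈V'} (q^{v'} − 1) as rational functions over ℚ, then U = U' and V = V'. In other words, the representation of a rational function as a quotient of products of polynomials q^k − 1 with disjoint multisets of exponents is unique. -/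
open Polynomial

/-- If `X ^ m - 1` is a factor of a product of polynomials `X ^ b - 1` with `0 < b ≤ m`,
then `m` is one of the exponents `b`. -/
theorem mem_of_X_pow_sub_one_dvd_prod {B : Multiset ℕ} {m : ℕ} (hm : 0 < m)
    (hB : ∀ b ∈ B, 0 < b) (hBm : ∀ b ∈ B, b ≤ m)
    (h : (X : ℚ[X]) ^ m - 1 ∣ (B.map fun b => (X : ℚ[X]) ^ b - 1).prod) : m ∈ B := by
  have hζ := Complex.isPrimitiveRoot_exp m hm.ne'
  set ζ := Complex.exp (2 * Real.pi * Complex.I / m)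
  have h0 : aeval ζ (B.map fun b => (X : ℚ[X]) ^ b - 1).prod = 0 :=
    aeval_eq_zero_of_dvd_aeval_eq_zero h (by simp [hζ.pow_eq_one])
  rw [map_multiset_prod, Multiset.prod_eq_zero_iff, Multiset.map_map] at h0
  obtain ⟨b, hb, hb0⟩ := Multiset.mem_map.mp h0
  have hmb : m ∣ b := hζ.dvd_of_pow_eq_one b (by simpa [sub_eq_zero] using hb0)
  rwa [(Nat.le_of_dvd (hB b hb) hmb).antisymm (hBm b hb)]

/-- A product of polynomials `X ^ k - 1` with positive exponents is nonzero. -/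
theorem prod_X_pow_sub_one_ne_zero {A : Multiset ℕ} (hA : ∀ a ∈ A, 0 < a) :
    (A.map fun a => (X : ℚ[X]) ^ a - 1).prod ≠ 0 := by
  rw [Ne, Multiset.prod_eq_zero_iff, Multiset.mem_map]
  rintro ⟨a, ha, h0⟩
  exact X_pow_sub_C_ne_zero (hA a ha) (1 : ℚ) (by simpa using h0)

/-- A multiset of positive integers is determined by the product of the polynomials
`X ^ k - 1` over it. -/
theorem eq_of_prod_X_pow_sub_one_eq {A B : Multiset ℕ}
    (hA : ∀ a ∈ A, 0 < a) (hB : ∀ b ∈ B, 0 < b)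
    (h : (A.map fun a => (X : ℚ[X]) ^ a - 1).prod = (B.map fun b => (X : ℚ[X]) ^ b - 1).prod) :
    A = B := by
  induction hn : A.card generalizing A B with
  | zero =>
    obtain rfl := Multiset.card_eq_zero.mp hn
    refine (Multiset.eq_zero_of_forall_notMem fun b hb => ?_).symm
    have hdvd := Multiset.dvd_prod (Multiset.mem_map_of_mem (fun b => (X : ℚ[X]) ^ b - 1) hb)
    rw [← h] at hdvd
    simpa using mem_of_X_pow_sub_one_dvd_prod (hB b hb) hA (by simp) hdvd
  | succ n ih =>
    have hne : (A + B).toFinset.Nonempty := by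
      obtain ⟨a, ha⟩ := Multiset.card_pos_iff_exists_mem.mp (show 0 < A.card by lia)
      exact ⟨a, by simp [ha]⟩
    obtain ⟨m, hmem, hmax⟩ := (A + B).toFinset.exists_max_image id hne
    simp only [Multiset.mem_toFinset, Multiset.mem_add, id] at hmem hmax
    have hmA : m ∈ A := hmem.elim id fun hm =>
      mem_of_X_pow_sub_one_dvd_prod (hB m hm) hA (fun a ha => hmax a (.inl ha))
        (h ▸ Multiset.dvd_prod (Multiset.mem_map_of_mem (fun b => (X : ℚ[X]) ^ b - 1) hm))
    have hmB : m ∈ B :=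
      mem_of_X_pow_sub_one_dvd_prod (hA m hmA) hB (fun b hb => hmax b (.inr hb))
        (h ▸ Multiset.dvd_prod (Multiset.mem_map_of_mem (fun b => (X : ℚ[X]) ^ b - 1) hmA))
    obtain ⟨A, rfl⟩ := Multiset.exists_cons_of_mem hmA
    obtain ⟨B, rfl⟩ := Multiset.exists_cons_of_mem hmB
    have hm0 : (X : ℚ[X]) ^ m - 1 ≠ 0 := by
      simpa using X_pow_sub_C_ne_zero (hA m hmA) (1 : ℚ)
    simp only [Multiset.map_cons, Multiset.prod_cons] at h
    rw [ih (fun a ha => hA a (Multiset.mem_cons_of_mem ha))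
      (fun b hb => hB b (Multiset.mem_cons_of_mem hb)) (mul_left_cancel₀ hm0 h)
      (by simpa using hn)]

/-- Let `U, V` be disjoint finite multisets of positive integers and `U', V'`
disjoint finite multisets of positive integers.  If
`∏_{u∈U}(q^u−1) / ∏_{v∈V}(q^v−1) = ∏_{u'∈U'}(q^{u'}−1) / ∏_{v'∈V'}(q^{v'}−1)`
in `RatFunc ℚ`, then `U = U'` and `V = V'`. -/
theorem quotient_prod_F_unique (U V U' V' : Multiset ℕ)
    (hU : ∀ u ∈ U, 0 < u) (hV : ∀ v ∈ V, 0 < v)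
    (hU' : ∀ u ∈ U', 0 < u) (hV' : ∀ v ∈ V', 0 < v)
    (hUV : Disjoint U V) (hU'V' : Disjoint U' V')
    (h : (algebraMap (Polynomial ℚ) (RatFunc ℚ)
            (U.map (fun u => (X : Polynomial ℚ) ^ u - 1)).prod) /
         (algebraMap (Polynomial ℚ) (RatFunc ℚ)
            (V.map (fun v => (X : Polynomial ℚ) ^ v - 1)).prod) =
         (algebraMap (Polynomial ℚ) (RatFunc ℚ)
            (U'.map (fun u => (X : Polynomial ℚ) ^ u - 1)).prod) /
         (algebraMap (Polynomial ℚ) (RatFunc ℚ)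
            (V'.map (fun v => (X : Polynomial ℚ) ^ v - 1)).prod)) :
    U = U' ∧ V = V' := by
  have hne {A : Multiset ℕ} (hA : ∀ a ∈ A, 0 < a) :=
    (map_ne_zero_iff _ (RatFunc.algebraMap_injective ℚ)).mpr (prod_X_pow_sub_one_ne_zero hA)
  rw [div_eq_div_iff (hne hV) (hne hV'), ← map_mul, ← map_mul] at h
  have hsum : U + V' = U' + V := by
    refine eq_of_prod_X_pow_sub_one_eq ?_ ?_ ?_
    · exact fun a ha => (Multiset.mem_add.mp ha).elim (hU a) (hV' a)
    · exact fun a ha => (Multiset.mem_add.mp ha).elim (hU' a) (hV a)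
    · simpa using RatFunc.algebraMap_injective ℚ h
  have hcount (a : ℕ) : U.count a = U'.count a ∧ V.count a = V'.count a := by
    have h1 := congrArg (Multiset.count a) hsum
    have h2 : U.count a = 0 ∨ V.count a = 0 := by
      simp only [Multiset.count_eq_zero, ← not_and_or]
      exact fun hm => Multiset.disjoint_left.mp hUV hm.1 hm.2
    have h3 : U'.count a = 0 ∨ V'.count a = 0 := by
      simp only [Multiset.count_eq_zero, ← not_and_or]
      exact fun hm => Multiset.disjoint_left.mp hU'V' hm.1 hm.2
    simp only [Multiset.count_add] at h1
    omega
  exact ⟨Multiset.ext.mpr fun a => (hcount a).1, Multiset.ext.mpr fun a => (hcount a).2⟩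
end
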